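/- arXiv:1912.06599 — 2 statements merged into one kernel-verified Lean document; each statement's English description precedes it below -/
import Mathlib

section
/- There exists L₀ > 0 such that for every L ≥ L₀ there exists k₁ ∈ (0,1) such that for all k ∈ (0,k₁): 9L⁴ > 2048 K(k)⁴ (1 − k² + k⁴), and the periodic wave φ(x) = a + b(ψ(2K(k)x/L)² − E(k)/K(k)) (with a, b, c defined by the formulas below and ψ the solution of ψ'' = (2 − k²)ψ − 2ψ³, ψ(0) = 1, ψ'(0) = 0) satisfies φ(x) − c < 0 for all x ∈ ℝ. -/
/-- The complete elliptic integral of the first kind. -/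
noncomputable def ellipticK (k : ℝ) : ℝ :=
  ∫ θ in (0:ℝ)..(Real.pi / 2), 1 / Real.sqrt (1 - k ^ 2 * Real.sin θ ^ 2)

/-- The complete elliptic integral of the second kind. -/
noncomputable def ellipticE (k : ℝ) : ℝ :=
  ∫ θ in (0:ℝ)..(Real.pi / 2), Real.sqrt (1 - k ^ 2 * Real.sin θ ^ 2)

lemma one_sub_sq_mul_sin_sq_lower_bound {k : ℝ} (hk : k ^ 2 ≤ 1 / 4) (θ : ℝ) :
    3 / 4 ≤ 1 - k ^ 2 * Real.sin θ ^ 2 := by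
  nlinarith [Real.sin_sq_le_one θ, sq_nonneg (Real.sin θ), sq_nonneg k]

lemma ellipticK_pos {k : ℝ} (hk : k ^ 2 ≤ 1 / 4) : 0 < ellipticK k := by
  have hpos : ∀ θ : ℝ, 0 < Real.sqrt (1 - k ^ 2 * Real.sin θ ^ 2) := fun θ =>
    Real.sqrt_pos.2 (by linarith [one_sub_sq_mul_sin_sq_lower_bound hk θ])
  refine intervalIntegral.intervalIntegral_pos_of_pos ?_ (fun θ => one_div_pos.2 (hpos θ))
    Real.pi_div_two_pos
  refine Continuous.intervalIntegrable ?_ _ _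
  exact continuous_const.div (by fun_prop) fun θ => (hpos θ).ne'

lemma ellipticK_le_four {k : ℝ} (hk : k ^ 2 ≤ 1 / 4) : ellipticK k ≤ 4 := by
  have h : ‖ellipticK k‖ ≤ 2 * |Real.pi / 2 - 0| := by
    refine intervalIntegral.norm_integral_le_of_norm_le_const fun θ _ => ?_
    have hs : 1 / 2 ≤ Real.sqrt (1 - k ^ 2 * Real.sin θ ^ 2) :=
      Real.le_sqrt_of_sq_le (by linarith [one_sub_sq_mul_sin_sq_lower_bound hk θ])
    rw [Real.norm_of_nonneg (by positivity), div_le_iff₀ (by linarith)]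
    linarith
  rw [sub_zero, abs_of_pos (by positivity)] at h
  linarith [le_abs_self (ellipticK k), Real.norm_eq_abs (ellipticK k), Real.pi_le_four]

/-- The lower bound `1 - k² ≤ dn²`, from conservation of energy. -/
lemma one_sub_sq_le_sq_of_dn_ode {k : ℝ} {ψ : ℝ → ℝ}
    (hψ : Differentiable ℝ ψ) (hψ' : Differentiable ℝ (deriv ψ))
    (hode : ∀ x, deriv (deriv ψ) x = (2 - k ^ 2) * ψ x - 2 * (ψ x) ^ 3)
    (h0 : ψ 0 = 1) (h0' : deriv ψ 0 = 0) (x : ℝ) : 1 - k ^ 2 ≤ ψ x ^ 2 := by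
  have hd : ∀ y, HasDerivAt
      (fun z => deriv ψ z ^ 2 - ((2 - k ^ 2) * ψ z ^ 2 - ψ z ^ 4)) 0 y := by
    intro y
    have h1 := (hψ y).hasDerivAt
    have h2 := (hψ' y).hasDerivAt
    refine ((h2.pow 2).sub (((h1.pow 2).const_mul (2 - k ^ 2)).sub (h1.pow 4))).congr_deriv ?_
    rw [hode]
    push_cast
    ring
  have henergy := is_const_of_deriv_eq_zero (fun y => (hd y).differentiableAt)
    (fun y => (hd y).deriv) x 0
  simp only [h0, h0'] at henergy
  by_contra! h
  nlinarith [sq_nonneg (deriv ψ x), mul_pos (sub_pos.2 h)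
    (show 0 < 1 - ψ x ^ 2 by linarith [sq_nonneg k])]

theorem wave_below_speed :
    ∃ L₀ > (0:ℝ), ∀ L ≥ L₀, ∃ k₁ ∈ Set.Ioo (0:ℝ) 1, ∀ k ∈ Set.Ioo (0:ℝ) k₁,
      9 * L ^ 4 > 2048 * (ellipticK k) ^ 4 * (1 - k ^ 2 + k ^ 4) ∧
      ∀ (Δ a b c : ℝ),
        Δ = Real.sqrt (9 * L ^ 4 - 2048 * (ellipticK k) ^ 4 * (1 - k ^ 2 + k ^ 4)) →
        b = -32 * (ellipticK k) ^ 2 / L ^ 2 →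
        c = ((3 / 2) * L ^ 2 - Δ / 2) / L ^ 2 →
        a = -(1 / (3 * L ^ 2)) * (-32 * (2 - k ^ 2) * (ellipticK k) ^ 2
            + 96 * (ellipticE k) * (ellipticK k) + (3 / 2) * L ^ 2 - Δ / 2) →
        ∀ ψ : ℝ → ℝ, Differentiable ℝ ψ → Differentiable ℝ (deriv ψ) →
          (∀ x, deriv (deriv ψ) x = (2 - k ^ 2) * ψ x - 2 * (ψ x) ^ 3) →
          ψ 0 = 1 → deriv ψ 0 = 0 →
          ∀ φ : ℝ → ℝ,
            (∀ x, φ x = a + b * ((ψ (2 * ellipticK k * x / L)) ^ 2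
                - ellipticE k / ellipticK k)) →
            ∀ x, φ x - c < 0 := by
  refine ⟨100, by norm_num, fun L hL => ⟨1 / 2, by norm_num, fun k hk => ?_⟩⟩
  obtain ⟨hk0, hk1⟩ := hk
  have hk2 : k ^ 2 ≤ 1 / 4 := by nlinarith
  have hK := ellipticK_pos hk2
  have hK4 : ellipticK k ^ 4 ≤ 4 ^ 4 := pow_le_pow_left₀ hK.le (ellipticK_le_four hk2) 4
  have hL4 : (100 : ℝ) ^ 4 ≤ L ^ 4 := pow_le_pow_left₀ (by norm_num) hL 4
  have hL0 : 0 < L := by linarith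
  have hq0 : 0 ≤ 1 - k ^ 2 + k ^ 4 := by nlinarith [sq_nonneg (k ^ 2)]
  have hq1 : 1 - k ^ 2 + k ^ 4 ≤ 1 := by nlinarith [sq_nonneg k]
  refine ⟨by nlinarith [mul_le_mul hK4 hq1 hq0 (by norm_num)], ?_⟩
  intro Δ a b c hΔ hb hc ha ψ hψ hψ' hode h0 h0' φ hφ x
  have hΔ_le : Δ ≤ 3 * L ^ 2 := by
    rw [hΔ]
    refine Real.sqrt_le_iff.2 ⟨by positivity, ?_⟩
    nlinarith [mul_nonneg (pow_pos hK 4).le hq0]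
  have hdn := one_sub_sq_le_sq_of_dn_ode hψ hψ' hode h0 h0' (2 * ellipticK k * x / L)
  have hval : φ x - c = (32 * ellipticK k ^ 2 * ((2 - k ^ 2) / 3
      - ψ (2 * ellipticK k * x / L) ^ 2) + 2 / 3 * (Δ - 3 * L ^ 2)) / L ^ 2 := by
    rw [hφ, ha, hb, hc]
    generalize ψ (2 * ellipticK k * x / L) = y
    field_simp
    ring
  rw [hval]
  refine div_neg_of_neg_of_pos ?_ (by positivity)
  have hneg : 32 * ellipticK k ^ 2 * ((2 - k ^ 2) / 3
      - ψ (2 * ellipticK k * x / L) ^ 2) < 0 :=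
    mul_neg_of_pos_of_neg (by positivity) (by linarith)
  linarith
end

section
/- Let L > 0 and let u : ℝ × ℝ → ℝ, (x,t) ↦ u(x,t), be infinitely differentiable, spatially L-periodic, and satisfy u_t − u_txx = u u_xxx + 2u_x u_xx − 3u² u_x on ℝ × ℝ. Then the function t ↦ −∫₀^L (u(x,t)⁴/4 + u(x,t) u_x(x,t)²/2) dx is constant in t. -/
/-- Partial derivative with respect to the first (spatial) variable
of a function `u x t`. -/
noncomputable def pderivX (u : ℝ → ℝ → ℝ) : ℝ → ℝ → ℝ :=
  fun x t => deriv (fun y => u y t) x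

/-- Partial derivative with respect to the second (temporal) variable
of a function `u x t`. -/
noncomputable def pderivT (u : ℝ → ℝ → ℝ) : ℝ → ℝ → ℝ :=
  fun x t => deriv (fun s => u x s) t

section PartialDerivatives

open scoped ContDiff

variable {u : ℝ → ℝ → ℝ}

theorem hasDerivAt_fst_of_contDiff (hu : ContDiff ℝ ∞ (fun p : ℝ × ℝ => u p.1 p.2)) (x t : ℝ) :
    HasDerivAt (fun y => u y t) (fderiv ℝ (fun p : ℝ × ℝ => u p.1 p.2) (x, t) (1, 0)) x := by
  have hd := (hu.differentiable (by simp) (x, t)).hasFDerivAt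
  exact hd.comp_hasDerivAt x ((hasDerivAt_id x).prodMk (hasDerivAt_const x t))

theorem hasDerivAt_snd_of_contDiff (hu : ContDiff ℝ ∞ (fun p : ℝ × ℝ => u p.1 p.2)) (x t : ℝ) :
    HasDerivAt (fun s => u x s) (fderiv ℝ (fun p : ℝ × ℝ => u p.1 p.2) (x, t) (0, 1)) t := by
  have hd := (hu.differentiable (by simp) (x, t)).hasFDerivAt
  exact hd.comp_hasDerivAt t ((hasDerivAt_const t x).prodMk (hasDerivAt_id t))

theorem pderivX_eq_fderiv (hu : ContDiff ℝ ∞ (fun p : ℝ × ℝ => u p.1 p.2)) (x t : ℝ) :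
    pderivX u x t = fderiv ℝ (fun p : ℝ × ℝ => u p.1 p.2) (x, t) (1, 0) :=
  (hasDerivAt_fst_of_contDiff hu x t).deriv

theorem pderivT_eq_fderiv (hu : ContDiff ℝ ∞ (fun p : ℝ × ℝ => u p.1 p.2)) (x t : ℝ) :
    pderivT u x t = fderiv ℝ (fun p : ℝ × ℝ => u p.1 p.2) (x, t) (0, 1) :=
  (hasDerivAt_snd_of_contDiff hu x t).deriv

theorem hasDerivAt_pderivX (hu : ContDiff ℝ ∞ (fun p : ℝ × ℝ => u p.1 p.2)) (x t : ℝ) :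
    HasDerivAt (fun y => u y t) (pderivX u x t) x :=
  (hasDerivAt_fst_of_contDiff hu x t).differentiableAt.hasDerivAt

theorem hasDerivAt_pderivT (hu : ContDiff ℝ ∞ (fun p : ℝ × ℝ => u p.1 p.2)) (x t : ℝ) :
    HasDerivAt (fun s => u x s) (pderivT u x t) t :=
  (hasDerivAt_snd_of_contDiff hu x t).differentiableAt.hasDerivAt

theorem contDiff_pderivX (hu : ContDiff ℝ ∞ (fun p : ℝ × ℝ => u p.1 p.2)) :
    ContDiff ℝ ∞ (fun p : ℝ × ℝ => pderivX u p.1 p.2) := by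
  simp only [pderivX_eq_fderiv hu]
  exact (hu.fderiv_right (m := ∞) (by simp)).clm_apply contDiff_const

theorem contDiff_pderivT (hu : ContDiff ℝ ∞ (fun p : ℝ × ℝ => u p.1 p.2)) :
    ContDiff ℝ ∞ (fun p : ℝ × ℝ => pderivT u p.1 p.2) := by
  simp only [pderivT_eq_fderiv hu]
  exact (hu.fderiv_right (m := ∞) (by simp)).clm_apply contDiff_const

theorem pderivT_pderivX_comm (hu : ContDiff ℝ ∞ (fun p : ℝ × ℝ => u p.1 p.2)) (x t : ℝ) :
    pderivT (pderivX u) x t = pderivX (pderivT u) x t := by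
  have hdiff := (hu.fderiv_right (m := ∞) (by simp)).differentiable (by simp) (x, t)
  have hsymm : IsSymmSndFDerivAt ℝ (fun p : ℝ × ℝ => u p.1 p.2) (x, t) :=
    hu.contDiffAt.isSymmSndFDerivAt
      (by simpa using WithTop.coe_le_coe.2 (le_top : (2 : ℕ∞) ≤ ⊤))
  rw [pderivT_eq_fderiv (contDiff_pderivX hu), pderivX_eq_fderiv (contDiff_pderivT hu)]
  simp only [pderivX_eq_fderiv hu, pderivT_eq_fderiv hu, Prod.mk.eta]
  rw [fderiv_clm_apply hdiff (differentiableAt_const _),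
    fderiv_clm_apply hdiff (differentiableAt_const _)]
  simpa using hsymm.eq (0, 1) (1, 0)

theorem pderivX_add_period {L : ℝ} (hper : ∀ x t, u (x + L) t = u x t) (x t : ℝ) :
    pderivX u (x + L) t = pderivX u x t := by
  unfold pderivX
  rw [← deriv_comp_add_const]
  simp only [hper]

theorem pderivT_add_period {L : ℝ} (hper : ∀ x t, u (x + L) t = u x t) (x t : ℝ) :
    pderivT u (x + L) t = pderivT u x t := by
  simp only [pderivT, hper]

end PartialDerivatives

/-- A density `e` satisfying a conservation law `e_t = F_x = g` with `F` taking equal values at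
the endpoints has constant integral. -/
theorem intervalIntegral_eq_of_conservation_law {a b : ℝ} {e F g : ℝ → ℝ → ℝ}
    (he : ∀ x t, HasDerivAt (fun s => e x s) (g x t) t)
    (hF : ∀ x t, HasDerivAt (fun y => F y t) (g x t) x)
    (hec : ∀ t, Continuous fun x => e x t)
    (hg : Continuous fun p : ℝ × ℝ => g p.1 p.2)
    (hab : ∀ t, F b t = F a t) (t₁ t₂ : ℝ) :
    ∫ x in a..b, e x t₁ = ∫ x in a..b, e x t₂ := by
  have hgx (x : ℝ) : Continuous fun t => g x t :=
    hg.comp (continuous_const.prodMk continuous_id)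
  have hgt (t : ℝ) : Continuous fun x => g x t :=
    hg.comp (continuous_id.prodMk continuous_const)
  have htime (x : ℝ) : ∫ t in t₁..t₂, g x t = e x t₂ - e x t₁ :=
    intervalIntegral.integral_eq_sub_of_hasDerivAt (fun t _ => he x t)
      ((hgx x).intervalIntegrable _ _)
  have hspace (t : ℝ) : ∫ x in a..b, g x t = 0 := by
    rw [intervalIntegral.integral_eq_sub_of_hasDerivAt (fun x _ => hF x t)
      ((hgt t).intervalIntegrable _ _), hab, sub_self]
  have hswap : ∫ x in a..b, ∫ t in t₁..t₂, g x t = ∫ t in t₁..t₂, ∫ x in a..b, g x t :=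
    MeasureTheory.intervalIntegral_intervalIntegral_swap 
      ((hg.continuousOn.integrableOn_compact
        (isCompact_uIcc.prod isCompact_uIcc)).mono_set
          (Set.prod_mono Set.uIoc_subset_uIcc Set.uIoc_subset_uIcc))
  simp only [htime, hspace, intervalIntegral.integral_zero] at hswap
  rw [intervalIntegral.integral_sub ((hec t₂).intervalIntegrable _ _)
    ((hec t₁).intervalIntegrable _ _)] at hswap
  linarith

theorem mCH_conservation_E (L : ℝ) (hL : 0 < L) (u : ℝ → ℝ → ℝ)
    (hsmooth : ContDiff ℝ (⊤ : ℕ∞) (fun p : ℝ × ℝ => u p.1 p.2))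
    (hper : ∀ x t, u (x + L) t = u x t)
    (hpde : ∀ x t, pderivT u x t - pderivX (pderivX (pderivT u)) x t
        = u x t * pderivX (pderivX (pderivX u)) x t
          + 2 * pderivX u x t * pderivX (pderivX u) x t
          - 3 * (u x t) ^ 2 * pderivX u x t) :
    ∀ t₁ t₂ : ℝ,
      -∫ x in (0:ℝ)..L, ((u x t₁) ^ 4 / 4 + u x t₁ * (pderivX u x t₁) ^ 2 / 2)
        = -∫ x in (0:ℝ)..L, ((u x t₂) ^ 4 / 4 + u x t₂ * (pderivX u x t₂) ^ 2 / 2) := by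
  intro t₁ t₂
  have hv := contDiff_pderivT hsmooth
  have hvx := contDiff_pderivX hv
  have hux := contDiff_pderivX hsmooth
  have huxx := contDiff_pderivX hux
  have hcu := hsmooth.continuous
  have hcux := hux.continuous
  have hcv := hv.continuous
  have hcvx := hvx.continuous
  have hper_v := pderivT_add_period hper
  have hper_vx := pderivX_add_period hper_v
  have hper_ux := pderivX_add_period hper
  have hper_uxx := pderivX_add_period hper_ux
  congr 1
  refine intervalIntegral_eq_of_conservation_law
    (e := fun x t => (u x t) ^ 4 / 4 + u x t * (pderivX u x t) ^ 2 / 2)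
    (F := fun x t => u x t * pderivX u x t * pderivT u x t
      - ((u x t * pderivX (pderivX u) x t + (pderivX u x t) ^ 2 / 2 - (u x t) ^ 3
          + pderivX (pderivT u) x t) ^ 2 - (pderivT u x t) ^ 2) / 2)
    (g := fun x t => (u x t) ^ 3 * pderivT u x t + pderivT u x t * (pderivX u x t) ^ 2 / 2
      + u x t * pderivX u x t * pderivX (pderivT u) x t)
    (fun x t => ?_) (fun x t => ?_) (fun t => ?_) (by fun_prop) (fun t => ?_) t₁ t₂
  · have h0 := hasDerivAt_pderivT hsmooth x t
    have h1 := hasDerivAt_pderivT hux x t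
    rw [pderivT_pderivX_comm hsmooth] at h1
    refine (((h0.fun_pow 4).div_const 4).fun_add
      ((h0.fun_mul (h1.fun_pow 2)).div_const 2)).congr_deriv ?_
    push_cast
    ring
  · have h0 := hasDerivAt_pderivX hsmooth x t
    have h1 := hasDerivAt_pderivX hux x t
    have h2 := hasDerivAt_pderivX huxx x t
    have h3 := hasDerivAt_pderivX hv x t
    have h4 := hasDerivAt_pderivX hvx x t
    have hflux := (((h0.fun_mul h2).fun_add ((h1.fun_pow 2).div_const 2)).fun_sub
      (h0.fun_pow 3)).fun_add h4
    refine (((h0.fun_mul h1).fun_mul h3).fun_sub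
      (((hflux.fun_pow 2).fun_sub (h3.fun_pow 2)).div_const 2)).congr_deriv ?_
    push_cast
    linear_combination ((u x t * pderivX (pderivX u) x t + (pderivX u x t) ^ 2 / 2 - (u x t) ^ 3
      + pderivX (pderivT u) x t)) * hpde x t
  · have hxt : Continuous fun x : ℝ => (x, t) := continuous_id.prodMk continuous_const
    have hu_t := hcu.comp hxt
    have hux_t := hcux.comp hxt
    simp only [Function.comp_def] at hu_t hux_t
    fun_prop
  · have h := fun (w : ℝ → ℝ → ℝ) (hw : ∀ x t, w (x + L) t = w x t) => by
      simpa using hw 0 t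
    simp only [h _ hper, h _ hper_v, h _ hper_vx, h _ hper_ux, h _ hper_uxx]
end
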